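/- arXiv:2405.19361 — 2 statements merged into one kernel-verified Lean document; each statement's English description precedes it below -/
import Mathlib

section
/- For all nonnegative integers m and n and all x > 0, the double inequality −2(m+n+1)!/(m!·n!) < Y_{m,n}(x) < −(m+n+1)!/(m!·n!) holds, where Y_{m,n}(x) = Φ^{(m+n+1)}(x) / (Φ^{(m)}(x) Φ^{(n)}(x)); the bounds are sharp in the sense that the lower and upper bounds cannot be replaced by any larger and smaller numbers respectively. -/
/-- `Φ x = x * ψ'(x) - 1`, where `ψ'` is the trigamma function, i.e. the second
derivative of the logarithm of the gamma function. -/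
noncomputable def Phi (x : ℝ) : ℝ :=
  x * iteratedDeriv 2 (fun y => Real.log (Real.Gamma y)) x - 1

noncomputable def Y (m n : ℕ) (x : ℝ) : ℝ :=
  iteratedDeriv (m + n + 1) Phi x / (iteratedDeriv m Phi x * iteratedDeriv n Phi x)

open Set Filter Topology MeasureTheory

theorem nonneg_of_hasDerivAt_nonneg {f f' : ℝ → ℝ} (h0 : f 0 = 0)
    (hf : ∀ t, HasDerivAt f (f' t) t) (hf' : ∀ t, 0 < t → 0 ≤ f' t) {t : ℝ} (ht : 0 ≤ t) :
    0 ≤ f t := by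
  have hmono : MonotoneOn f (Ici 0) := by
    apply monotoneOn_of_deriv_nonneg (convex_Ici 0)
    · exact fun x _ => (hf x).continuousAt.continuousWithinAt
    · exact fun x _ => (hf x).differentiableAt.differentiableWithinAt
    · intro x hx
      rw [interior_Ici] at hx
      rw [(hf x).deriv]
      exact hf' x hx
  have := hmono (mem_Ici.2 le_rfl) ht ht
  rwa [h0] at this

theorem one_add_sq_div_two_le_cosh {t : ℝ} (ht : 0 ≤ t) : 1 + t ^ 2 / 2 ≤ Real.cosh t := by
  have h : 0 ≤ Real.cosh t - (1 + t ^ 2 / 2) := by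
    refine nonneg_of_hasDerivAt_nonneg (f := fun t => Real.cosh t - (1 + t ^ 2 / 2))
      (f' := fun t => Real.sinh t - t) (by simp) (fun s => ?_) (fun s hs => ?_) ht
    · refine ((Real.hasDerivAt_cosh s).sub
        (((hasDerivAt_pow 2 s).div_const 2).const_add 1)).congr_deriv ?_
      norm_num
    · exact sub_nonneg.2 (Real.self_le_sinh_iff.2 hs.le)
  linarith

theorem sinh_le_mul_cosh {t : ℝ} (ht : 0 ≤ t) : Real.sinh t ≤ t * Real.cosh t := by
  have h : 0 ≤ t * Real.cosh t - Real.sinh t := by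
    refine nonneg_of_hasDerivAt_nonneg (f := fun t => t * Real.cosh t - Real.sinh t)
      (f' := fun t => t * Real.sinh t) (by simp) (fun s => ?_) (fun s hs => ?_) ht
    · refine (((hasDerivAt_id s).mul (Real.hasDerivAt_cosh s)).sub
        (Real.hasDerivAt_sinh s)).congr_deriv ?_
      simp
    · exact mul_nonneg hs.le (Real.sinh_nonneg_iff.2 hs.le)
  linarith

theorem two_mul_cosh_sub_one_le {t : ℝ} (ht : 0 ≤ t) :
    2 * (Real.cosh t - 1) ≤ t * Real.sinh t := by
  have h : 0 ≤ t * Real.sinh t - 2 * (Real.cosh t - 1) := by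
    refine nonneg_of_hasDerivAt_nonneg (f := fun t => t * Real.sinh t - 2 * (Real.cosh t - 1))
      (f' := fun t => t * Real.cosh t - Real.sinh t) (by simp) (fun s => ?_) (fun s hs => ?_) ht
    · refine (((hasDerivAt_id s).mul (Real.hasDerivAt_sinh s)).sub
        (((Real.hasDerivAt_cosh s).sub_const 1).const_mul 2)).congr_deriv ?_
      simp; ring
    · exact sub_nonneg.2 (sinh_le_mul_cosh hs.le)
  linarith

theorem sq_mul_sinh_le {t : ℝ} (ht : 0 ≤ t) :
    t ^ 2 * Real.sinh t ≤ (Real.cosh t - 1) * (Real.sinh t + t) := by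
  have h3 : ∀ t : ℝ, 0 < t → 0 ≤ 4 * Real.cosh t ^ 2 + 4 * Real.sinh t ^ 2 - 4 * Real.cosh t
      - 5 * t * Real.sinh t - t ^ 2 * Real.cosh t := by
    intro t ht
    have h1 := one_add_sq_div_two_le_cosh ht.le
    have h2 := sinh_le_mul_cosh ht.le
    have h3 := Real.self_le_sinh_iff.2 ht.le
    have h4 : 0 ≤ Real.cosh t * (Real.cosh t - 1 - t ^ 2 / 2) :=
      mul_nonneg (Real.cosh_pos t).le (by linarith)
    have h5 : 0 ≤ t * (t * Real.cosh t - Real.sinh t) := mul_nonneg ht.le (by linarith)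
    have h6 : 0 ≤ Real.sinh t * (Real.sinh t - t) := mul_nonneg (by linarith) (by linarith)
    nlinarith
  have h2 : ∀ t : ℝ, 0 < t → 0 ≤ 4 * Real.sinh t * Real.cosh t - Real.sinh t
      - 3 * t * Real.cosh t - t ^ 2 * Real.sinh t := by
    intro t ht
    refine nonneg_of_hasDerivAt_nonneg (f := fun t => 4 * Real.sinh t * Real.cosh t - Real.sinh t
      - 3 * t * Real.cosh t - t ^ 2 * Real.sinh t) (by simp) (fun s => ?_) h3 ht.le
    refine ((((((Real.hasDerivAt_sinh s).const_mul 4).mul (Real.hasDerivAt_cosh s)).sub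
      (Real.hasDerivAt_sinh s)).sub
      (((hasDerivAt_id s).const_mul 3).mul (Real.hasDerivAt_cosh s))).sub
      ((hasDerivAt_pow 2 s).mul (Real.hasDerivAt_sinh s))).congr_deriv ?_
    simp; ring
  have h1 : ∀ t : ℝ, 0 < t → 0 ≤ 2 * Real.sinh t ^ 2
      - t * Real.sinh t - t ^ 2 * Real.cosh t := by
    intro t ht
    refine nonneg_of_hasDerivAt_nonneg (f := fun t => 2 * Real.sinh t ^ 2
      - t * Real.sinh t - t ^ 2 * Real.cosh t) (by simp) (fun s => ?_) h2 ht.le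
    refine (((((Real.hasDerivAt_sinh s).pow 2).const_mul 2).sub
      ((hasDerivAt_id s).mul (Real.hasDerivAt_sinh s))).sub
      ((hasDerivAt_pow 2 s).mul (Real.hasDerivAt_cosh s))).congr_deriv ?_
    simp; ring
  have h0 : 0 ≤ (Real.cosh t - 1) * (Real.sinh t + t) - t ^ 2 * Real.sinh t := by
    refine nonneg_of_hasDerivAt_nonneg
      (f := fun t => (Real.cosh t - 1) * (Real.sinh t + t) - t ^ 2 * Real.sinh t)
      (by simp) (fun s => ?_) h1 ht
    refine ((((Real.hasDerivAt_cosh s).sub_const 1).mul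
      ((Real.hasDerivAt_sinh s).add (hasDerivAt_id s))).sub
      ((hasDerivAt_pow 2 s).mul (Real.hasDerivAt_sinh s))).congr_deriv ?_
    have := Real.cosh_sq s
    simp
    linear_combination this
  linarith

/-- The quotient `(sinh t - t) / (cosh t - 1)`, i.e. the derivative of `t * coth (t / 2)`. -/
noncomputable def coshQuot (t : ℝ) : ℝ := (Real.sinh t - t) / (Real.cosh t - 1)

theorem cosh_sub_one_pos {t : ℝ} (ht : 0 < t) : 0 < Real.cosh t - 1 :=
  sub_pos.2 (Real.one_lt_cosh.2 ht.ne')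

theorem coshQuot_pos {t : ℝ} (ht : 0 < t) : 0 < coshQuot t :=
  div_pos (sub_pos.2 (Real.self_lt_sinh_iff.2 ht)) (cosh_sub_one_pos ht)

theorem coshQuot_lt_one {t : ℝ} (ht : 0 < t) : coshQuot t < 1 := by
  rw [coshQuot, div_lt_one (cosh_sub_one_pos ht)]
  have := Real.add_one_lt_exp (x := -t) (by linarith)
  have := Real.cosh_sub_sinh t
  linarith

theorem coshQuot_le_self {t : ℝ} (ht : 0 < t) : coshQuot t ≤ t := by
  rw [coshQuot, div_le_iff₀ (cosh_sub_one_pos ht)]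
  linarith [sinh_le_mul_cosh ht.le]

theorem one_sub_two_div_le_coshQuot {t : ℝ} (ht : 0 < t) : 1 - 2 / t ≤ coshQuot t := by
  rw [coshQuot, le_div_iff₀ (cosh_sub_one_pos ht)]
  have h1 := one_add_sq_div_two_le_cosh ht.le
  have h2 := Real.cosh_sub_sinh t
  have h3 : Real.exp (-t) < 1 := Real.exp_lt_one_iff.2 (by linarith)
  have h4 : 2 / t * (t ^ 2 / 2) ≤ 2 / t * (Real.cosh t - 1) := by
    gcongr
    linarith
  have h5 : 2 / t * (t ^ 2 / 2) = t := by field_simp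
  linarith

theorem hasDerivAt_coshQuot {t : ℝ} (ht : 0 < t) : HasDerivAt coshQuot
    ((t * Real.sinh t - 2 * (Real.cosh t - 1)) / (Real.cosh t - 1) ^ 2) t := by
  refine (((Real.hasDerivAt_sinh t).sub (hasDerivAt_id t)).div
    ((Real.hasDerivAt_cosh t).sub_const 1) (cosh_sub_one_pos ht).ne').congr_deriv ?_
  congr 1
  simp
  linear_combination Real.cosh_sq t

theorem monotoneOn_coshQuot : MonotoneOn coshQuot (Ioi 0) := by
  apply monotoneOn_of_deriv_nonneg (convex_Ioi 0)
  · exact fun x hx => (hasDerivAt_coshQuot hx).continuousAt.continuousWithinAt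
  · rw [interior_Ioi]
    exact fun x hx => (hasDerivAt_coshQuot hx).differentiableAt.differentiableWithinAt
  · intro x hx
    rw [interior_Ioi] at hx
    rw [(hasDerivAt_coshQuot hx).deriv]
    exact div_nonneg (sub_nonneg.2 (two_mul_cosh_sub_one_le (le_of_lt hx))) (sq_nonneg _)

theorem antitoneOn_coshQuot_div : AntitoneOn (fun t => coshQuot t / t) (Ioi 0) := by
  have hd : ∀ t : ℝ, 0 < t → HasDerivAt (fun t => coshQuot t / t) _ t :=
    fun t ht => (hasDerivAt_coshQuot ht).div (hasDerivAt_id t) ht.ne'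
  apply antitoneOn_of_deriv_nonpos (convex_Ioi 0)
  · exact fun x hx => (hd x hx).continuousAt.continuousWithinAt
  · rw [interior_Ioi]
    exact fun x hx => (hd x hx).differentiableAt.differentiableWithinAt
  · intro t ht
    rw [interior_Ioi] at ht
    have ht' : 0 < t := ht
    rw [(hd t ht).deriv]
    refine div_nonpos_of_nonpos_of_nonneg ?_ (sq_nonneg _)
    have hc := cosh_sub_one_pos ht'
    have h : (t * Real.sinh t - 2 * (Real.cosh t - 1)) / (Real.cosh t - 1) ^ 2 * t
        - coshQuot t * 1 = (t ^ 2 * Real.sinh t - (Real.cosh t - 1) * (Real.sinh t + t))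
          / (Real.cosh t - 1) ^ 2 := by
      rw [coshQuot]
      field_simp
      ring
    rw [h]
    exact div_nonpos_of_nonpos_of_nonneg (sub_nonpos.2 (sq_mul_sinh_le ht'.le)) (sq_nonneg _)

theorem coshQuot_add_le {a b : ℝ} (ha : 0 < a) (hb : 0 < b) :
    coshQuot (a + b) ≤ coshQuot a + coshQuot b := by
  have hab : 0 < a + b := add_pos ha hb
  have h1 : coshQuot (a + b) / (a + b) ≤ coshQuot a / a :=
    antitoneOn_coshQuot_div ha hab (by linarith)
  have h2 : coshQuot (a + b) / (a + b) ≤ coshQuot b / b :=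
    antitoneOn_coshQuot_div hb hab (by linarith)
  rw [le_div_iff₀ ha] at h1
  rw [le_div_iff₀ hb] at h2
  have h3 : coshQuot (a + b) / (a + b) * (a + b) = coshQuot (a + b) := by field_simp
  linarith

/-- The weight whose Laplace transform is `Phi`. -/
noncomputable def phiWeight (t : ℝ) : ℝ := (1 + coshQuot t) / 2

theorem phiWeight_pos {t : ℝ} (ht : 0 < t) : 0 < phiWeight t := by
  have := coshQuot_pos ht
  unfold phiWeight; linarith

theorem phiWeight_lt_one {t : ℝ} (ht : 0 < t) : phiWeight t < 1 := by
  have := coshQuot_lt_one ht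
  unfold phiWeight; linarith

theorem phiWeight_mul_lt {a b : ℝ} (ha : 0 < a) (hb : 0 < b) :
    phiWeight a * phiWeight b < phiWeight (a + b) := by
  have h1 : phiWeight a ≤ phiWeight (a + b) := by
    have : coshQuot a ≤ coshQuot (a + b) :=
      monotoneOn_coshQuot ha (mem_Ioi.2 (add_pos ha hb)) (by linarith)
    unfold phiWeight; linarith
  nlinarith [phiWeight_pos ha, phiWeight_lt_one hb]

theorem phiWeight_lt_two_mul {a b : ℝ} (ha : 0 < a) (hb : 0 < b) :
    phiWeight (a + b) < 2 * (phiWeight a * phiWeight b) := by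
  have := coshQuot_add_le ha hb
  have := mul_pos (coshQuot_pos ha) (coshQuot_pos hb)
  unfold phiWeight
  nlinarith

theorem tendsto_phiWeight_nhdsGT : Tendsto phiWeight (𝓝[>] 0) (𝓝 (1 / 2)) := by
  have h : Tendsto coshQuot (𝓝[>] 0) (𝓝 0) := by
    refine tendsto_of_tendsto_of_tendsto_of_le_of_le' tendsto_const_nhds
      (tendsto_id.mono_left nhdsWithin_le_nhds) ?_ ?_
    · filter_upwards [self_mem_nhdsWithin] with t ht using (coshQuot_pos ht).le
    · filter_upwards [self_mem_nhdsWithin] with t ht using coshQuot_le_self ht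
  have := (h.const_add 1).div_const 2
  rw [add_zero] at this
  exact this

theorem tendsto_phiWeight_atTop : Tendsto phiWeight atTop (𝓝 1) := by
  have h : Tendsto coshQuot atTop (𝓝 1) := by
    have h2 : Tendsto (fun t : ℝ => 1 - 2 / t) atTop (𝓝 1) := by
      simpa using (tendsto_const_nhds (x := (2 : ℝ)).div_atTop tendsto_id).const_sub 1
    refine tendsto_of_tendsto_of_tendsto_of_le_of_le' h2 tendsto_const_nhds ?_ ?_
    · filter_upwards [eventually_gt_atTop 0] with t ht using one_sub_two_div_le_coshQuot ht
    · filter_upwards [eventually_gt_atTop 0] with t ht using (coshQuot_lt_one ht).le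
  have := (h.const_add 1).div_const 2
  norm_num at this
  exact this

theorem measurable_phiWeight : Measurable phiWeight := by
  unfold phiWeight coshQuot
  have := Real.continuous_sinh.measurable
  have := Real.continuous_cosh.measurable
  fun_prop

theorem integral_pow_mul_sub_pow (m n : ℕ) (u : ℝ) :
    ∫ t in (0:ℝ)..u, t ^ m * (u - t) ^ n =
      (m.factorial * n.factorial / (m + n + 1).factorial : ℝ) * u ^ (m + n + 1) := by
  induction m generalizing n with
  | zero =>
    have : ∫ t in (0:ℝ)..u, (u - t) ^ n = u ^ (n + 1) / (n + 1) := by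
      rw [intervalIntegral.integral_comp_sub_left (fun t => t ^ n) u]
      simp
    simp only [pow_zero, one_mul, this]
    rw [zero_add, Nat.factorial_succ]
    have := Nat.factorial_ne_zero n
    push_cast
    field_simp
    simp
  | succ m ih =>
    have hp := intervalIntegral.integral_mul_deriv_eq_deriv_mul (a := 0) (b := u)
      (u := fun t => t ^ (m + 1)) (u' := fun t => (m + 1) * t ^ m)
      (v := fun t => -(u - t) ^ (n + 1) / (n + 1)) (v' := fun t => (u - t) ^ n)
      (fun t _ => by simpa using hasDerivAt_pow (m + 1) t)
      (fun t _ => by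
        refine (((((hasDerivAt_id t).const_sub u).pow (n + 1)).neg).div_const
          ((n : ℝ) + 1)).congr_deriv ?_
        simp
        field_simp)
      ((by fun_prop : Continuous _).intervalIntegrable _ _)
      ((by fun_prop : Continuous _).intervalIntegrable _ _)
    rw [hp]
    have he : ∀ t : ℝ, (m + 1) * t ^ m * (-(u - t) ^ (n + 1) / (n + 1)) =
        (-(m + 1) / (n + 1)) * (t ^ m * (u - t) ^ (n + 1)) := fun t => by ring
    simp only [he, intervalIntegral.integral_const_mul, ih (n + 1)]
    have e : m + (n + 1) + 1 = m + 1 + n + 1 := by ring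
    rw [e, Nat.factorial_succ n, Nat.factorial_succ m]
    have := Nat.factorial_ne_zero (m + 1 + n + 1)
    push_cast
    field_simp
    simp

theorem integrableOn_pow_mul_exp (k : ℕ) {x : ℝ} (hx : 0 < x) :
    IntegrableOn (fun t => t ^ k * Real.exp (-(x * t))) (Ioi 0) := by
  have h := integrableOn_rpow_mul_exp_neg_mul_rpow (p := 1) (s := k) (b := x)
    (by linarith [(Nat.cast_nonneg k : (0:ℝ) ≤ k)]) one_pos hx
  simpa [Real.rpow_natCast] using h

theorem integral_pow_mul_exp (k : ℕ) {x : ℝ} (hx : 0 < x) :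
    ∫ t in Ioi (0:ℝ), t ^ k * Real.exp (-(x * t)) = k.factorial / x ^ (k + 1) := by
  have h := Real.integral_rpow_mul_exp_neg_mul_Ioi (a := k + 1) (r := x) (by positivity) hx
  simp only [add_sub_cancel_right, Real.rpow_natCast] at h
  rw [h, Real.Gamma_nat_eq_factorial]
  have : (1 / x) ^ ((k:ℝ) + 1) = (1 / x) ^ (k + 1) := by
    rw [← Real.rpow_natCast]; push_cast; rfl
  rw [this, one_div, inv_pow, mul_comm, div_eq_mul_inv]

/-- The Laplace transform of `t ^ k * w t` at `x`. -/
noncomputable def laplaceMoment (w : ℝ → ℝ) (k : ℕ) (x : ℝ) : ℝ :=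
  ∫ t in Ioi (0:ℝ), t ^ k * w t * Real.exp (-(x * t))

theorem abs_laplace_integrand_le {w : ℝ → ℝ}
    (hb : ∀ t, 0 < t → |w t| ≤ 1 + t) (k : ℕ) (x : ℝ) {t : ℝ} (ht : 0 < t) :
    |t ^ k * w t * Real.exp (-(x * t))| ≤
      t ^ k * Real.exp (-(x * t)) + t ^ (k + 1) * Real.exp (-(x * t)) := by
  rw [abs_mul, abs_mul, abs_of_pos (pow_pos ht k), Real.abs_exp]
  calc t ^ k * |w t| * Real.exp (-(x * t)) ≤ t ^ k * (1 + t) * Real.exp (-(x * t)) := by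
        gcongr
        exact hb t ht
    _ = _ := by ring

theorem integrableOn_laplace_integrand {w : ℝ → ℝ} (hw : Measurable w)
    (hb : ∀ t, 0 < t → |w t| ≤ 1 + t) (k : ℕ) {x : ℝ} (hx : 0 < x) :
    IntegrableOn (fun t => t ^ k * w t * Real.exp (-(x * t))) (Ioi 0) := by
  refine Integrable.mono' ((integrableOn_pow_mul_exp k hx).add (integrableOn_pow_mul_exp (k + 1) hx))
    (by fun_prop) ?_
  filter_upwards [ae_restrict_mem measurableSet_Ioi] with t ht
  exact abs_laplace_integrand_le hb k x ht

theorem hasDerivAt_laplaceMoment {w : ℝ → ℝ} (hw : Measurable w)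
    (hb : ∀ t, 0 < t → |w t| ≤ 1 + t) (k : ℕ) {x : ℝ} (hx : 0 < x) :
    HasDerivAt (laplaceMoment w k) (-laplaceMoment w (k + 1) x) x := by
  have hx2 : 0 < x / 2 := by linarith
  have h := (hasDerivAt_integral_of_dominated_loc_of_deriv_le (μ := volume.restrict (Ioi (0:ℝ)))
    (s := Ioi (x / 2)) (x₀ := x) (F := fun y t => t ^ k * w t * Real.exp (-(y * t)))
    (F' := fun y t => -(t ^ (k + 1) * w t * Real.exp (-(y * t))))
    (bound := fun t => t ^ (k + 1) * Real.exp (-(x / 2 * t)) +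
      t ^ (k + 1 + 1) * Real.exp (-(x / 2 * t)))
    (Ioi_mem_nhds (by linarith)) (Eventually.of_forall fun y => by fun_prop)
    (integrableOn_laplace_integrand hw hb k hx) (by fun_prop) ?_
    ((integrableOn_pow_mul_exp (k + 1) hx2).add (integrableOn_pow_mul_exp (k + 1 + 1) hx2)) ?_).2
  · rw [integral_neg] at h
    exact h
  · filter_upwards [ae_restrict_mem measurableSet_Ioi] with t ht y hy
    have ht' : 0 < t := ht
    have hy' : x / 2 < y := hy
    rw [norm_neg]
    refine (abs_laplace_integrand_le hb (k + 1) y ht).trans ?_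
    gcongr
  · filter_upwards with t y _
    refine ((((hasDerivAt_id y).mul_const t).neg.exp).const_mul (t ^ k * w t)).congr_deriv ?_
    simp
    ring

/-- The weight whose Laplace transform is the trigamma function. -/
noncomputable def trigammaWeight (t : ℝ) : ℝ := t / (1 - Real.exp (-t))

theorem one_sub_exp_neg_pos {t : ℝ} (ht : 0 < t) : 0 < 1 - Real.exp (-t) :=
  sub_pos.2 (Real.exp_lt_one_iff.2 (by linarith))

theorem one_le_trigammaWeight {t : ℝ} (ht : 0 < t) : 1 ≤ trigammaWeight t := by
  rw [trigammaWeight, le_div_iff₀ (one_sub_exp_neg_pos ht)]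
  linarith [Real.add_one_le_exp (-t)]

theorem trigammaWeight_le {t : ℝ} (ht : 0 < t) : trigammaWeight t ≤ 1 + t := by
  rw [trigammaWeight, div_le_iff₀ (one_sub_exp_neg_pos ht)]
  have h : (1 + t) * Real.exp (-t) ≤ 1 := by
    rw [Real.exp_neg, ← div_eq_mul_inv, div_le_one (Real.exp_pos t)]
    linarith [Real.add_one_le_exp t]
  linarith

theorem measurable_trigammaWeight : Measurable trigammaWeight := by
  unfold trigammaWeight
  fun_prop

theorem abs_trigammaWeight_le (t : ℝ) (ht : 0 < t) : |trigammaWeight t| ≤ 1 + t := by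
  rw [abs_of_pos (by linarith [one_le_trigammaWeight ht])]
  exact trigammaWeight_le ht

theorem abs_phiWeight_le (t : ℝ) (ht : 0 < t) : |phiWeight t| ≤ 1 + t := by
  rw [abs_of_pos (phiWeight_pos ht)]
  linarith [phiWeight_lt_one ht]

theorem hasDerivAt_trigammaWeight {t : ℝ} (ht : 0 < t) :
    HasDerivAt trigammaWeight (phiWeight t) t := by
  have h0 := one_sub_exp_neg_pos ht
  refine ((hasDerivAt_id t).div ((hasDerivAt_neg t).exp.const_sub 1) h0.ne').congr_deriv ?_
  have he : Real.exp t = (Real.exp (-t))⁻¹ := by rw [Real.exp_neg, inv_inv]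
  rw [phiWeight, coshQuot, Real.cosh_eq, Real.sinh_eq, he]
  generalize hE : Real.exp (-t) = E at *
  have hE0 : 0 < E := hE ▸ Real.exp_pos _
  have h2 : (E⁻¹ + E) / 2 - 1 = (1 - E) ^ 2 / (2 * E) := by field_simp; ring
  rw [h2]
  simp
  field_simp
  ring

/-- The trigamma function as a Laplace transform. -/
noncomputable def trigammaIntegral : ℝ → ℝ := laplaceMoment trigammaWeight 0

theorem integrableOn_trigamma {x : ℝ} (hx : 0 < x) :
    IntegrableOn (fun t => t ^ 0 * trigammaWeight t * Real.exp (-(x * t))) (Ioi 0) :=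
  integrableOn_laplace_integrand measurable_trigammaWeight abs_trigammaWeight_le 0 hx

theorem hasDerivAt_trigammaIntegral {x : ℝ} (hx : 0 < x) :
    HasDerivAt trigammaIntegral (-laplaceMoment trigammaWeight 1 x) x :=
  hasDerivAt_laplaceMoment measurable_trigammaWeight abs_trigammaWeight_le 0 hx

theorem trigammaIntegral_add_one {x : ℝ} (hx : 0 < x) :
    trigammaIntegral (x + 1) = trigammaIntegral x - 1 / x ^ 2 := by
  have h := integral_pow_mul_exp 1 hx
  have h2 : ∫ t in Ioi (0:ℝ), t ^ 1 * Real.exp (-(x * t)) =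
      trigammaIntegral x - trigammaIntegral (x + 1) := by
    unfold trigammaIntegral laplaceMoment
    rw [← integral_sub (integrableOn_trigamma hx) (integrableOn_trigamma (by linarith))]
    refine setIntegral_congr_fun measurableSet_Ioi fun t ht => ?_
    have h0 := one_sub_exp_neg_pos ht
    have he : Real.exp (-((x + 1) * t)) = Real.exp (-(x * t)) * Real.exp (-t) := by
      rw [← Real.exp_add]; ring_nf
    simp only [he, trigammaWeight]
    field_simp
  rw [h] at h2
  simp at h2 ⊢
  linarith

theorem trigammaIntegral_nonneg (x : ℝ) : 0 ≤ trigammaIntegral x := by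
  refine setIntegral_nonneg measurableSet_Ioi fun t ht => ?_
  have := one_le_trigammaWeight ht
  have ht' : 0 < t := ht
  positivity

theorem trigammaIntegral_anti {x y : ℝ} (hx : 0 < x) (hxy : x ≤ y) :
    trigammaIntegral y ≤ trigammaIntegral x := by
  refine setIntegral_mono_on (integrableOn_trigamma (by linarith)) (integrableOn_trigamma hx)
    measurableSet_Ioi fun t ht => ?_
  have := one_le_trigammaWeight ht
  have ht' : 0 < t := ht
  gcongr

theorem trigammaIntegral_le {x : ℝ} (hx : 0 < x) : trigammaIntegral x ≤ 1 / x + 1 / x ^ 2 := by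
  have h0 := integral_pow_mul_exp 0 hx
  have h1 := integral_pow_mul_exp 1 hx
  simp only [zero_add, Nat.factorial_zero, Nat.factorial_one, Nat.cast_one, pow_one,
    one_add_one_eq_two, pow_zero, one_mul] at h0 h1
  have i0 := integrableOn_pow_mul_exp 0 hx
  have i1 := integrableOn_pow_mul_exp 1 hx
  simp only [pow_zero, one_mul, pow_one] at i0 i1
  rw [← h0, ← h1, ← integral_add i0 i1]
  refine setIntegral_mono_on (integrableOn_trigamma hx) (i0.add i1)
    measurableSet_Ioi fun t ht => ?_
  have := trigammaWeight_le ht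
  have := mul_le_mul_of_nonneg_right this (Real.exp_pos (-(x * t))).le
  linarith

theorem tendsto_trigammaIntegral_atTop : Tendsto trigammaIntegral atTop (𝓝 0) := by
  have h : Tendsto (fun x : ℝ => 1 / x + 1 / x ^ 2) atTop (𝓝 (0 + 0)) :=
    (tendsto_const_nhds.div_atTop tendsto_id).add
      (tendsto_const_nhds.div_atTop (tendsto_pow_atTop two_ne_zero))
  rw [add_zero] at h
  refine tendsto_of_tendsto_of_tendsto_of_le_of_le' tendsto_const_nhds h
    (Eventually.of_forall trigammaIntegral_nonneg) ?_
  filter_upwards [eventually_gt_atTop 0] with x hx using trigammaIntegral_le hx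

/-- The antiderivative of `trigammaIntegral` vanishing at `1`. -/
noncomputable def trigammaPrimitive (x : ℝ) : ℝ := ∫ t in (1:ℝ)..x, trigammaIntegral t

theorem hasDerivAt_trigammaPrimitive {x : ℝ} (hx : 0 < x) :
    HasDerivAt trigammaPrimitive (trigammaIntegral x) x := by
  have hc : ∀ y ∈ Ioi (0:ℝ), ContinuousAt trigammaIntegral y :=
    fun y hy => (hasDerivAt_trigammaIntegral hy).continuousAt
  refine intervalIntegral.integral_hasDerivAt_right ?_
    (ContinuousAt.stronglyMeasurableAtFilter isOpen_Ioi hc x hx) (hc x hx)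
  refine ContinuousOn.intervalIntegrable fun y hy => (hc y ?_).continuousWithinAt
  exact lt_of_lt_of_le (lt_min one_pos hx) hy.1

theorem abs_trigammaPrimitive_sub_le {x y : ℝ} (hx : 0 < x) (hxy : x ≤ y) :
    |trigammaPrimitive y - trigammaPrimitive x| ≤ trigammaIntegral x * (y - x) := by
  have h := Convex.norm_image_sub_le_of_norm_hasDerivWithin_le (f := trigammaPrimitive)
    (f' := trigammaIntegral) (s := Ici x) (x := x) (y := y) (C := trigammaIntegral x)
    (fun z hz => (hasDerivAt_trigammaPrimitive (lt_of_lt_of_le hx hz)).hasDerivWithinAt)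
    (fun z hz => by
      rw [Real.norm_of_nonneg (trigammaIntegral_nonneg z)]
      exact trigammaIntegral_anti hx hz) (convex_Ici x) self_mem_Ici hxy
  rwa [Real.norm_eq_abs, Real.norm_of_nonneg (sub_nonneg.2 hxy)] at h

theorem trigammaPrimitive_add_one {x : ℝ} (hx : 0 < x) :
    trigammaPrimitive (x + 1) = trigammaPrimitive x + 1 / x := by
  have hd : ∀ y : ℝ, 0 < y → HasDerivAt
      (fun y => trigammaPrimitive (y + 1) - trigammaPrimitive y - 1 / y) 0 y := by
    intro y hy
    have h1 := (hasDerivAt_trigammaPrimitive (x := y + 1) (by linarith)).comp_add_const y 1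
    simp only [one_div]
    refine ((h1.sub (hasDerivAt_trigammaPrimitive hy)).sub (hasDerivAt_inv hy.ne')).congr_deriv ?_
    rw [trigammaIntegral_add_one hy]
    ring
  have hconst : ∀ y : ℝ, 0 < y → trigammaPrimitive (y + 1) - trigammaPrimitive y - 1 / y =
      trigammaPrimitive (x + 1) - trigammaPrimitive x - 1 / x := fun y hy =>
    isOpen_Ioi.is_const_of_deriv_eq_zero (f := fun y =>
      trigammaPrimitive (y + 1) - trigammaPrimitive y - 1 / y) isPreconnected_Ioi
      (fun z hz => (hd z hz).differentiableAt.differentiableWithinAt)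
      (fun z hz => (hd z hz).deriv) hy hx
  have hlim : Tendsto (fun y => trigammaPrimitive (y + 1) - trigammaPrimitive y - 1 / y) atTop
      (𝓝 (0 - 0)) := by
    refine Tendsto.sub ?_ (tendsto_const_nhds.div_atTop tendsto_id)
    refine squeeze_zero_norm' ?_ tendsto_trigammaIntegral_atTop
    filter_upwards [eventually_gt_atTop 0] with y hy
    simpa using abs_trigammaPrimitive_sub_le hy (by linarith : y ≤ y + 1)
  have hlim2 : Tendsto (fun y => trigammaPrimitive (y + 1) - trigammaPrimitive y - 1 / y) atTop
      (𝓝 (trigammaPrimitive (x + 1) - trigammaPrimitive x - 1 / x)) :=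
    tendsto_const_nhds.congr' (by
      filter_upwards [eventually_gt_atTop 0] with y hy using (hconst y hy).symm)
  have := tendsto_nhds_unique hlim hlim2
  linarith

theorem differentiableAt_log_Gamma {x : ℝ} (hx : 0 < x) :
    DifferentiableAt ℝ (fun y => Real.log (Real.Gamma y)) x :=
  (Real.differentiableAt_Gamma fun m => by linarith [(Nat.cast_nonneg m : (0:ℝ) ≤ m)]).log
    (Real.Gamma_pos_of_pos hx).ne'

theorem deriv_log_Gamma_add_one {x : ℝ} (hx : 0 < x) :
    deriv (fun y => Real.log (Real.Gamma y)) (x + 1) =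
      deriv (fun y => Real.log (Real.Gamma y)) x + 1 / x := by
  rw [← deriv_comp_add_const]
  have h : (fun y => Real.log (Real.Gamma (y + 1))) =ᶠ[𝓝 x]
      fun y => Real.log (Real.Gamma y) + Real.log y := by
    filter_upwards [Ioi_mem_nhds hx] with y hy
    have hy' : 0 < y := hy
    rw [Real.Gamma_add_one hy'.ne', Real.log_mul hy'.ne' (Real.Gamma_pos_of_pos hy).ne', add_comm]
  rw [h.deriv_eq, deriv_fun_add (differentiableAt_log_Gamma hx) (Real.differentiableAt_log hx.ne'),
    Real.deriv_log, one_div]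

theorem deriv_log_Gamma_mono {x y : ℝ} (hx : 0 < x) (hxy : x ≤ y) :
    deriv (fun y => Real.log (Real.Gamma y)) x ≤ deriv (fun y => Real.log (Real.Gamma y)) y :=
  (Real.convexOn_log_Gamma.monotoneOn_deriv fun _ hz => differentiableAt_log_Gamma hz) hx
    (mem_Ioi.2 (hx.trans_le hxy)) hxy

/-- The digamma function differs from `trigammaPrimitive` by a constant: the difference is
1-periodic and, because the digamma function increases and `trigammaIntegral` vanishes at infinity,
also monotone. -/
theorem deriv_log_Gamma_sub_trigammaPrimitive {x : ℝ} (hx : 0 < x) :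
    deriv (fun y => Real.log (Real.Gamma y)) x - trigammaPrimitive x =
      deriv (fun y => Real.log (Real.Gamma y)) 1 - trigammaPrimitive 1 := by
  set N : ℝ → ℝ := fun x => deriv (fun y => Real.log (Real.Gamma y)) x - trigammaPrimitive x with hN
  have hper : ∀ (k : ℕ) (x : ℝ), 0 < x → N (x + k) = N x := by
    intro k
    induction k with
    | zero => simp
    | succ k ih =>
      intro x hx
      have hk : 0 < x + k := by positivity
      have h := ih x hx
      have e : x + ((k + 1 : ℕ) : ℝ) = (x + k) + 1 := by push_cast; ring
      rw [← h, e]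
      simp only [hN]
      rw [deriv_log_Gamma_add_one hk, trigammaPrimitive_add_one hk]
      ring
  have hmono : ∀ x y : ℝ, 0 < x → x ≤ y → N x ≤ N y := by
    intro x y hx hxy
    have hlim : Tendsto (fun k : ℕ => -(trigammaIntegral (x + k) * (y - x))) atTop (𝓝 0) := by
      have := ((tendsto_trigammaIntegral_atTop.comp (tendsto_atTop_add_const_left _ x
        tendsto_natCast_atTop_atTop)).mul_const (y - x)).neg
      simpa using this
    have hle : ∀ k : ℕ, -(trigammaIntegral (x + k) * (y - x)) ≤ N y - N x := by
      intro k
      rw [← hper k x hx, ← hper k y (by linarith)]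
      have hk : 0 < x + k := by positivity
      have h1 := deriv_log_Gamma_mono hk (by linarith : x + k ≤ y + k)
      have h2 := abs_trigammaPrimitive_sub_le hk (by linarith : x + k ≤ y + k)
      have h3 := (abs_le.1 h2).2
      rw [add_sub_add_right_eq_sub] at h3
      simp only [hN]
      linarith
    have := le_of_tendsto' hlim hle
    linarith
  have hle : ∀ x y : ℝ, 0 < x → 0 < y → N x ≤ N y := by
    intro x y hx hy
    obtain ⟨k, hk⟩ := exists_nat_gt x
    rw [← hper k y hy]
    exact hmono x _ hx (by linarith)
  exact le_antisymm (hle x 1 hx one_pos) (hle 1 x one_pos hx)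

theorem iteratedDeriv_two_log_Gamma {x : ℝ} (hx : 0 < x) :
    iteratedDeriv 2 (fun y => Real.log (Real.Gamma y)) x = trigammaIntegral x := by
  rw [iteratedDeriv_succ, iteratedDeriv_one]
  have h : deriv (fun y => Real.log (Real.Gamma y)) =ᶠ[𝓝 x] fun y => trigammaPrimitive y +
      (deriv (fun y => Real.log (Real.Gamma y)) 1 - trigammaPrimitive 1) := by
    filter_upwards [Ioi_mem_nhds hx] with y hy
    linarith [deriv_log_Gamma_sub_trigammaPrimitive hy]
  rw [h.deriv_eq]
  exact ((hasDerivAt_trigammaPrimitive hx).add_const _).deriv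

theorem mul_trigammaIntegral {x : ℝ} (hx : 0 < x) :
    x * trigammaIntegral x - 1 = laplaceMoment phiWeight 0 x := by
  have hi := (integrableOn_trigamma hx).const_mul (-x)
  have hj := integrableOn_laplace_integrand measurable_phiWeight abs_phiWeight_le 0 hx
  simp only [pow_zero, one_mul] at hi hj
  have he0 : Tendsto (fun t : ℝ => Real.exp (-(x * t))) (𝓝[>] 0) (𝓝 1) := by
    have : Continuous fun t : ℝ => Real.exp (-(x * t)) := by fun_prop
    simpa using (this.tendsto 0).mono_left nhdsWithin_le_nhds
  have hg0 : Tendsto trigammaWeight (𝓝[>] 0) (𝓝 1) := by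
    have h1 : Tendsto (fun t : ℝ => 1 + t) (𝓝[>] 0) (𝓝 1) := by
      have : Continuous fun t : ℝ => 1 + t := by fun_prop
      simpa using (this.tendsto 0).mono_left nhdsWithin_le_nhds
    refine tendsto_of_tendsto_of_tendsto_of_le_of_le' tendsto_const_nhds h1 ?_ ?_
    · filter_upwards [self_mem_nhdsWithin] with t ht using one_le_trigammaWeight ht
    · filter_upwards [self_mem_nhdsWithin] with t ht using trigammaWeight_le ht
  have htop : Tendsto (fun t => trigammaWeight t * Real.exp (-(x * t))) atTop (𝓝 0) := by
    have h0 := (Real.tendsto_exp_neg_atTop_nhds_zero.comp (tendsto_id.const_mul_atTop hx))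
    have h1 := ((Real.tendsto_pow_mul_exp_neg_atTop_nhds_zero 1).comp
      (tendsto_id.const_mul_atTop hx)).const_mul (1 / x)
    have h2 : Tendsto (fun t => (1 + t) * Real.exp (-(x * t))) atTop (𝓝 (0 + 1 / x * 0)) := by
      refine (h0.add h1).congr fun t => ?_
      simp
      field_simp
    rw [mul_zero, add_zero] at h2
    refine squeeze_zero_norm' ?_ h2
    filter_upwards [eventually_gt_atTop 0] with t ht
    rw [norm_mul, Real.norm_eq_abs, Real.norm_eq_abs, Real.abs_exp]
    gcongr
    exact abs_trigammaWeight_le t ht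
  have h := integral_Ioi_mul_deriv_eq_deriv_mul (a := (0:ℝ)) (u := trigammaWeight) (u' := phiWeight)
    (v := fun t => Real.exp (-(x * t))) (v' := fun t => -x * Real.exp (-(x * t)))
    (a' := 1 * 1) (b' := 0)
    (fun t ht => hasDerivAt_trigammaWeight ht)
    (fun t _ => by
      refine (((hasDerivAt_id t).const_mul x).neg.exp).congr_deriv ?_
      simp; ring)
    (IntegrableOn.congr_fun hi (fun t _ => by simp; ring) measurableSet_Ioi) hj (hg0.mul he0) htop
  have h2 : ∫ t in Ioi (0:ℝ), trigammaWeight t * (-x * Real.exp (-(x * t))) =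
      -x * trigammaIntegral x := by
    unfold trigammaIntegral laplaceMoment
    rw [← integral_const_mul]
    refine setIntegral_congr_fun measurableSet_Ioi fun t _ => ?_
    simp; ring
  rw [h2] at h
  unfold laplaceMoment
  simp only [pow_zero, one_mul]
  linarith
theorem iteratedDeriv_Phi (k : ℕ) {x : ℝ} (hx : 0 < x) :
    iteratedDeriv k Phi x = (-1) ^ k * laplaceMoment phiWeight k x := by
  induction k generalizing x with
  | zero =>
    rw [iteratedDeriv_zero, Phi, iteratedDeriv_two_log_Gamma hx, mul_trigammaIntegral hx]
    simp
  | succ k ih =>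
    have h : iteratedDeriv k Phi =ᶠ[𝓝 x] fun y => (-1) ^ k * laplaceMoment phiWeight k y := by
      filter_upwards [Ioi_mem_nhds hx] with y hy using ih hy
    rw [iteratedDeriv_succ, h.deriv_eq, ((hasDerivAt_laplaceMoment measurable_phiWeight
      abs_phiWeight_le k hx).const_mul _).deriv]
    ring

theorem setIntegral_Ioi_pos {f : ℝ → ℝ} (hf : IntegrableOn f (Ioi 0)) (h : ∀ t, 0 < t → 0 < f t) :
    0 < ∫ t in Ioi (0:ℝ), f t := by
  rw [setIntegral_pos_iff_support_of_nonneg_ae _ hf]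
  · have : Ioi (0:ℝ) ⊆ Function.support f ∩ Ioi 0 := fun t ht => ⟨(h t ht).ne', ht⟩
    refine lt_of_lt_of_le ?_ (measure_mono this)
    simp
  · filter_upwards [ae_restrict_mem measurableSet_Ioi] with t ht using (h t ht).le

theorem integrableOn_phi (k : ℕ) {x : ℝ} (hx : 0 < x) :
    IntegrableOn (fun t => t ^ k * phiWeight t * Real.exp (-(x * t))) (Ioi 0) :=
  integrableOn_laplace_integrand measurable_phiWeight abs_phiWeight_le k hx

theorem laplaceMoment_phiWeight_pos (k : ℕ) {x : ℝ} (hx : 0 < x) :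
    0 < laplaceMoment phiWeight k x := by
  refine setIntegral_Ioi_pos (integrableOn_phi k hx) fun t ht => ?_
  have := phiWeight_pos ht
  positivity

theorem abs_phiWeight_le_one {t : ℝ} (ht : 0 ≤ t) : |phiWeight t| ≤ 1 := by
  rcases ht.eq_or_lt with rfl | ht
  · norm_num [phiWeight, coshQuot]
  · rw [abs_of_pos (phiWeight_pos ht)]
    exact (phiWeight_lt_one ht).le

/-- The convolution whose integral is the product of two Laplace transforms. -/
noncomputable def phiConv (m n : ℕ) (x u : ℝ) : ℝ :=
  ∫ t in (0:ℝ)..u, (t ^ m * phiWeight t * Real.exp (-(x * t))) *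
    ((u - t) ^ n * phiWeight (u - t) * Real.exp (-(x * (u - t))))

theorem integral_phiConv (m n : ℕ) {x : ℝ} (hx : 0 < x) :
    ∫ u in Ioi (0:ℝ), phiConv m n x u = laplaceMoment phiWeight m x * laplaceMoment phiWeight n x :=
  integral_posConvolution (integrableOn_phi m hx) (integrableOn_phi n hx)
    (ContinuousLinearMap.mul ℝ ℝ)

theorem integrableOn_phiConv (m n : ℕ) {x : ℝ} (hx : 0 < x) :
    IntegrableOn (phiConv m n x) (Ioi 0) := by
  have h := (integrable_posConvolution (integrableOn_phi m hx) (integrableOn_phi n hx)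
    (ContinuousLinearMap.mul ℝ ℝ)).integrableOn (s := Ioi 0)
  exact h.congr_fun (fun u hu => indicator_of_mem hu _) measurableSet_Ioi

theorem intervalIntegrable_phiConv (m n : ℕ) (x : ℝ) {u : ℝ} (hu : 0 < u) :
    IntervalIntegrable (fun t => (t ^ m * phiWeight t * Real.exp (-(x * t))) *
      ((u - t) ^ n * phiWeight (u - t) * Real.exp (-(x * (u - t))))) volume 0 u := by
  have hm := measurable_phiWeight
  refine IntervalIntegrable.mono_fun' (g := fun t => |t ^ m * Real.exp (-(x * t)) *
    ((u - t) ^ n * Real.exp (-(x * (u - t))))|)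
    ((by fun_prop : Continuous _).intervalIntegrable _ _) (by fun_prop) ?_
  filter_upwards [ae_restrict_mem measurableSet_uIoc] with t ht
  rw [uIoc_of_le hu.le] at ht
  have h1 := abs_phiWeight_le_one ht.1.le
  have h2 := abs_phiWeight_le_one (sub_nonneg.2 ht.2)
  rw [Real.norm_eq_abs]
  have e : (t ^ m * phiWeight t * Real.exp (-(x * t))) *
      ((u - t) ^ n * phiWeight (u - t) * Real.exp (-(x * (u - t)))) =
      (t ^ m * Real.exp (-(x * t)) * ((u - t) ^ n * Real.exp (-(x * (u - t))))) *
      (phiWeight t * phiWeight (u - t)) := by ring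
  rw [e, abs_mul _ (phiWeight t * phiWeight (u - t)), abs_mul (phiWeight t)]
  exact mul_le_of_le_one_right (abs_nonneg _) (mul_le_one₀ h1 (abs_nonneg _) h2)

theorem integral_const_weight (m n : ℕ) (x u : ℝ) :
    ∫ t in (0:ℝ)..u, t ^ m * (u - t) ^ n * (phiWeight u * Real.exp (-(x * u))) =
      (m.factorial * n.factorial / (m + n + 1).factorial : ℝ) *
        (u ^ (m + n + 1) * phiWeight u * Real.exp (-(x * u))) := by
  rw [intervalIntegral.integral_mul_const, integral_pow_mul_sub_pow]
  ring

theorem phiConv_integrand_eq (m n : ℕ) (x u t : ℝ) :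
    (t ^ m * phiWeight t * Real.exp (-(x * t))) *
      ((u - t) ^ n * phiWeight (u - t) * Real.exp (-(x * (u - t)))) =
    t ^ m * (u - t) ^ n * Real.exp (-(x * u)) * (phiWeight t * phiWeight (u - t)) := by
  have : Real.exp (-(x * u)) = Real.exp (-(x * t)) * Real.exp (-(x * (u - t))) := by
    rw [← Real.exp_add]; ring_nf
  rw [this]
  ring

theorem phiConv_lt (m n : ℕ) (x : ℝ) {u : ℝ} (hu : 0 < u) :
    phiConv m n x u < (m.factorial * n.factorial / (m + n + 1).factorial : ℝ) *
        (u ^ (m + n + 1) * phiWeight u * Real.exp (-(x * u))) := by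
  have hi : IntervalIntegrable (fun t => t ^ m * (u - t) ^ n *
      (phiWeight u * Real.exp (-(x * u)))) volume 0 u :=
    (by fun_prop : Continuous _).intervalIntegrable _ _
  rw [← integral_const_weight, phiConv, ← sub_pos,
    ← intervalIntegral.integral_sub hi (intervalIntegrable_phiConv m n x hu)]
  refine intervalIntegral.intervalIntegral_pos_of_pos_on
    (hi.sub (intervalIntegrable_phiConv m n x hu)) (fun t ht => ?_) hu
  have hut : 0 < u - t := sub_pos.2 ht.2
  have h := phiWeight_mul_lt ht.1 hut
  rw [add_sub_cancel] at h
  rw [phiConv_integrand_eq]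
  have h2 : 0 < t ^ m * (u - t) ^ n * Real.exp (-(x * u)) :=
    mul_pos (mul_pos (pow_pos ht.1 m) (pow_pos hut n)) (Real.exp_pos _)
  linarith [mul_lt_mul_of_pos_left h h2]

theorem lt_two_mul_phiConv (m n : ℕ) (x : ℝ) {u : ℝ} (hu : 0 < u) :
    (m.factorial * n.factorial / (m + n + 1).factorial : ℝ) *
        (u ^ (m + n + 1) * phiWeight u * Real.exp (-(x * u))) < 2 * phiConv m n x u := by
  have hi : IntervalIntegrable (fun t => t ^ m * (u - t) ^ n *
      (phiWeight u * Real.exp (-(x * u)))) volume 0 u :=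
    (by fun_prop : Continuous _).intervalIntegrable _ _
  have hj := (intervalIntegrable_phiConv m n x hu).const_mul 2
  rw [← integral_const_weight, phiConv, ← intervalIntegral.integral_const_mul, ← sub_pos,
    ← intervalIntegral.integral_sub hj hi]
  refine intervalIntegral.intervalIntegral_pos_of_pos_on (hj.sub hi) (fun t ht => ?_) hu
  have hut : 0 < u - t := sub_pos.2 ht.2
  have h := phiWeight_lt_two_mul ht.1 hut
  rw [add_sub_cancel] at h
  rw [phiConv_integrand_eq]
  have h2 : 0 < t ^ m * (u - t) ^ n * Real.exp (-(x * u)) :=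
    mul_pos (mul_pos (pow_pos ht.1 m) (pow_pos hut n)) (Real.exp_pos _)
  linarith [mul_lt_mul_of_pos_left h h2]

theorem laplaceMoment_mul_lt (m n : ℕ) {x : ℝ} (hx : 0 < x) :
    laplaceMoment phiWeight m x * laplaceMoment phiWeight n x <
      (m.factorial * n.factorial / (m + n + 1).factorial : ℝ) *
        laplaceMoment phiWeight (m + n + 1) x := by
  have hi := (integrableOn_phi (m + n + 1) hx).const_mul
    (m.factorial * n.factorial / (m + n + 1).factorial : ℝ)
  have hj := integrableOn_phiConv m n hx
  rw [← integral_phiConv m n hx, ← sub_pos, laplaceMoment, ← integral_const_mul,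
    ← integral_sub hi hj]
  exact setIntegral_Ioi_pos (hi.sub hj) fun u hu => sub_pos.2 (phiConv_lt m n x hu)

theorem laplaceMoment_lt_two_mul (m n : ℕ) {x : ℝ} (hx : 0 < x) :
    (m.factorial * n.factorial / (m + n + 1).factorial : ℝ) *
        laplaceMoment phiWeight (m + n + 1) x <
      2 * (laplaceMoment phiWeight m x * laplaceMoment phiWeight n x) := by
  have hi := (integrableOn_phi (m + n + 1) hx).const_mul
    (m.factorial * n.factorial / (m + n + 1).factorial : ℝ)
  have hj := (integrableOn_phiConv m n hx).const_mul 2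
  rw [← integral_phiConv m n hx, ← sub_pos, laplaceMoment, ← integral_const_mul,
    ← integral_const_mul, ← integral_sub hj hi]
  exact setIntegral_Ioi_pos (hj.sub hi) fun u hu => sub_pos.2 (lt_two_mul_phiConv m n x hu)

theorem pow_mul_laplaceMoment (k : ℕ) {x : ℝ} (hx : 0 < x) :
    x ^ (k + 1) * laplaceMoment phiWeight k x =
      ∫ s in Ioi (0:ℝ), s ^ k * phiWeight (s / x) * Real.exp (-s) := by
  have h := integral_comp_mul_left_Ioi
    (fun s => s ^ k * phiWeight (s / x) * Real.exp (-s)) 0 hx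
  rw [mul_zero, smul_eq_mul] at h
  rw [← mul_inv_cancel_left₀ hx.ne' (∫ s in Ioi (0:ℝ), _), ← h, laplaceMoment, pow_succ', mul_assoc,
    ← integral_const_mul]
  congr 1
  refine setIntegral_congr_fun measurableSet_Ioi fun t _ => ?_
  simp only [mul_div_cancel_left₀ t hx.ne', mul_pow]
  ring

theorem tendsto_pow_mul_laplaceMoment (k : ℕ) {l : Filter ℝ} [l.IsCountablyGenerated] {c : ℝ}
    (hl : ∀ᶠ x in l, 0 < x) (h : ∀ s : ℝ, 0 < s → Tendsto (fun x => phiWeight (s / x)) l (𝓝 c)) :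
    Tendsto (fun x => x ^ (k + 1) * laplaceMoment phiWeight k x) l (𝓝 (c * k.factorial)) := by
  have hi := integrableOn_pow_mul_exp k one_pos
  have hv := integral_pow_mul_exp k one_pos
  simp only [one_mul, one_pow, div_one] at hi hv
  have hm := measurable_phiWeight
  have hd : Tendsto (fun x => ∫ s in Ioi (0:ℝ), s ^ k * phiWeight (s / x) * Real.exp (-s)) l
      (𝓝 (∫ s in Ioi (0:ℝ), s ^ k * c * Real.exp (-s))) := by
    refine tendsto_integral_filter_of_dominated_convergence
      (fun s => s ^ k * Real.exp (-s)) (Eventually.of_forall fun x => by fun_prop) ?_ hi ?_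
    · filter_upwards [hl] with x hx
      filter_upwards [ae_restrict_mem measurableSet_Ioi] with s hs
      have hs' : 0 < s := hs
      rw [norm_mul, norm_mul, Real.norm_of_nonneg (pow_pos hs' k).le,
        Real.norm_of_nonneg (Real.exp_pos _).le]
      refine mul_le_mul_of_nonneg_right ?_ (Real.exp_pos _).le
      exact mul_le_of_le_one_right (pow_pos hs' k).le (abs_phiWeight_le_one (by positivity))
    · filter_upwards [ae_restrict_mem measurableSet_Ioi] with s hs
      exact ((h s hs).const_mul _).mul_const _
  have e : ∫ s in Ioi (0:ℝ), s ^ k * c * Real.exp (-s) = c * k.factorial := by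
    rw [← hv, ← integral_const_mul]
    congr 1
    ext s
    ring
  rw [e] at hd
  refine hd.congr' ?_
  filter_upwards [hl] with x hx using (pow_mul_laplaceMoment k hx).symm

theorem Y_eq_laplaceMoment (m n : ℕ) {x : ℝ} (hx : 0 < x) :
    Y m n x = -(laplaceMoment phiWeight (m + n + 1) x /
      (laplaceMoment phiWeight m x * laplaceMoment phiWeight n x)) := by
  rw [Y, iteratedDeriv_Phi _ hx, iteratedDeriv_Phi _ hx, iteratedDeriv_Phi _ hx]
  have h1 := (laplaceMoment_phiWeight_pos m hx).ne'
  have h2 := (laplaceMoment_phiWeight_pos n hx).ne'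
  have e : (-1 : ℝ) ^ (m + n + 1) = -((-1) ^ m * (-1) ^ n) := by ring
  rw [e]
  have h3 : (-1 : ℝ) ^ m ≠ 0 := by simp
  have h4 : (-1 : ℝ) ^ n ≠ 0 := by simp
  field_simp

theorem tendsto_Y (m n : ℕ) {l : Filter ℝ} [l.IsCountablyGenerated] {c : ℝ} (hc : c ≠ 0)
    (hl : ∀ᶠ x in l, 0 < x) (h : ∀ s : ℝ, 0 < s → Tendsto (fun x => phiWeight (s / x)) l (𝓝 c)) :
    Tendsto (Y m n) l
      (𝓝 (-(1 / c * (m + n + 1).factorial / (m.factorial * n.factorial)))) := by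
  have hm : (m.factorial : ℝ) ≠ 0 := by positivity
  have hn : (n.factorial : ℝ) ≠ 0 := by positivity
  have ht := ((tendsto_pow_mul_laplaceMoment (m + n + 1) hl h).div
    ((tendsto_pow_mul_laplaceMoment m hl h).mul (tendsto_pow_mul_laplaceMoment n hl h))
    (by positivity)).neg
  have e : c * (m + n + 1).factorial / (c * m.factorial * (c * n.factorial)) =
      1 / c * (m + n + 1).factorial / (m.factorial * n.factorial) := by
    field_simp
  rw [e] at ht
  refine ht.congr' ?_
  filter_upwards [hl] with x hx
  have h1 := (laplaceMoment_phiWeight_pos m hx).ne'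
  have h2 := (laplaceMoment_phiWeight_pos n hx).ne'
  rw [Y_eq_laplaceMoment m n hx]
  simp only [Pi.div_apply]
  congr 1
  field_simp
  ring

theorem Y_double_inequality (m n : ℕ) :
    (∀ x ∈ Set.Ioi (0:ℝ),
      -(2 * (Nat.factorial (m + n + 1) : ℝ) / (Nat.factorial m * Nat.factorial n)) < Y m n x ∧
      Y m n x < -((Nat.factorial (m + n + 1) : ℝ) / (Nat.factorial m * Nat.factorial n))) ∧
    (∀ L : ℝ, (∀ x ∈ Set.Ioi (0:ℝ), L < Y m n x) →
      L ≤ -(2 * (Nat.factorial (m + n + 1) : ℝ) / (Nat.factorial m * Nat.factorial n))) ∧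
    (∀ U : ℝ, (∀ x ∈ Set.Ioi (0:ℝ), Y m n x < U) →
      -((Nat.factorial (m + n + 1) : ℝ) / (Nat.factorial m * Nat.factorial n)) ≤ U) := by
  refine ⟨fun x hx => ?_, fun L hL => ?_, fun U hU => ?_⟩
  · have hm : (0 : ℝ) < m.factorial * n.factorial := by positivity
    have hN : (0 : ℝ) < (m + n + 1).factorial := by positivity
    have hF := mul_pos (laplaceMoment_phiWeight_pos m hx) (laplaceMoment_phiWeight_pos n hx)
    have h1 := laplaceMoment_mul_lt m n hx
    have h2 := laplaceMoment_lt_two_mul m n hx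
    rw [div_mul_eq_mul_div, lt_div_iff₀ hN] at h1
    rw [div_mul_eq_mul_div, div_lt_iff₀ hN] at h2
    rw [Y_eq_laplaceMoment m n hx, neg_lt_neg_iff, neg_lt_neg_iff, div_lt_div_iff₀ hF hm,
      div_lt_div_iff₀ hm hF]
    constructor <;> linarith
  · have h := tendsto_Y m n (l := atTop) (c := 1 / 2) (by norm_num) (eventually_gt_atTop 0)
      fun s hs => tendsto_phiWeight_nhdsGT.comp (tendsto_nhdsWithin_iff.2
        ⟨tendsto_const_nhds.div_atTop tendsto_id, by
          filter_upwards [eventually_gt_atTop 0] with x hx using div_pos hs hx⟩)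
    rw [one_div_one_div] at h
    refine ge_of_tendsto h ?_
    filter_upwards [eventually_gt_atTop 0] with x hx using (hL x hx).le
  · have h := tendsto_Y m n (l := 𝓝[>] 0) (c := 1) one_ne_zero self_mem_nhdsWithin
      fun s hs => tendsto_phiWeight_atTop.comp
        (tendsto_inv_nhdsGT_zero.const_mul_atTop hs)
    rw [div_one, one_mul] at h
    refine le_of_tendsto h ?_
    filter_upwards [self_mem_nhdsWithin] with x hx using (hU x hx).le
end

section
/- Let A, B : (0,∞) → ℝ be functions such that B(t) > 0 for all t > 0, the Laplace transforms ∫_0^∞ A(t) e^{−xt} dt and ∫_0^∞ B(t) e^{−xt} dt exist (the integrals converge) for every x > 0, and the ratio t ↦ A(t)/B(t) is increasing on (0,∞). Then the function x ↦ (∫_0^∞ A(t) e^{−xt} dt) / (∫_0^∞ B(t) e^{−xt} dt) is decreasing on (0,∞). -/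
open MeasureTheory

/-- If `a₁ ⊗ b₀ - a₀ ⊗ b₁ - b₁ ⊗ a₀ + b₀ ⊗ a₁` is nonpositive on `S × S`, then so is its double
integral `2 * (∫ a₁ * ∫ b₀ - ∫ a₀ * ∫ b₁)`. -/
theorem setIntegral_mul_le_of_symmetrized_nonpos {α : Type*} [MeasurableSpace α] {μ : Measure α}
    {S : Set α} (hS : MeasurableSet S) {a₀ a₁ b₀ b₁ : α → ℝ}
    (ha₀ : IntegrableOn a₀ S μ) (ha₁ : IntegrableOn a₁ S μ)
    (hb₀ : IntegrableOn b₀ S μ) (hb₁ : IntegrableOn b₁ S μ)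
    (h : ∀ s ∈ S, ∀ t ∈ S, a₁ s * b₀ t - a₀ s * b₁ t - b₁ s * a₀ t + b₀ s * a₁ t ≤ 0) :
    (∫ t in S, a₁ t ∂μ) * (∫ t in S, b₀ t ∂μ) ≤ (∫ t in S, a₀ t ∂μ) * (∫ t in S, b₁ t ∂μ) := by
  have inner : ∀ s ∈ S, a₁ s * (∫ t in S, b₀ t ∂μ) - a₀ s * (∫ t in S, b₁ t ∂μ)
      - b₁ s * (∫ t in S, a₀ t ∂μ) + b₀ s * (∫ t in S, a₁ t ∂μ) ≤ 0 := by
    intro s hs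
    have key := setIntegral_nonpos (μ := μ) hS (h s hs)
    rwa [integral_add (((hb₀.const_mul _).sub' (hb₁.const_mul _)).sub' (ha₀.const_mul _))
        (ha₁.const_mul _),
      integral_sub ((hb₀.const_mul _).sub' (hb₁.const_mul _)) (ha₀.const_mul _),
      integral_sub (hb₀.const_mul _) (hb₁.const_mul _), integral_const_mul, integral_const_mul,
      integral_const_mul, integral_const_mul] at key
  have outer := setIntegral_nonpos (μ := μ) hS inner
  rw [integral_add (((ha₁.mul_const _).sub' (ha₀.mul_const _)).sub' (hb₁.mul_const _))
      (hb₀.mul_const _),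
    integral_sub ((ha₁.mul_const _).sub' (ha₀.mul_const _)) (hb₁.mul_const _),
    integral_sub (ha₁.mul_const _) (ha₀.mul_const _), integral_mul_const, integral_mul_const,
    integral_mul_const, integral_mul_const] at outer
  linarith

theorem laplace_ratio_antitone (A B : ℝ → ℝ)
    (hB : ∀ t ∈ Set.Ioi (0:ℝ), 0 < B t)
    (hA_int : ∀ x ∈ Set.Ioi (0:ℝ),
      IntegrableOn (fun t => A t * Real.exp (-x * t)) (Set.Ioi 0))
    (hB_int : ∀ x ∈ Set.Ioi (0:ℝ),
      IntegrableOn (fun t => B t * Real.exp (-x * t)) (Set.Ioi 0))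
    (hratio : MonotoneOn (fun t => A t / B t) (Set.Ioi 0)) :
    AntitoneOn
      (fun x => (∫ t in Set.Ioi (0:ℝ), A t * Real.exp (-x * t)) /
        (∫ t in Set.Ioi (0:ℝ), B t * Real.exp (-x * t)))
      (Set.Ioi 0) := by
  intro x hx y hy hxy
  have hpos : ∀ z ∈ Set.Ioi (0:ℝ), 0 < ∫ t in Set.Ioi (0:ℝ), B t * Real.exp (-z * t) := by
    intro z hz
    have hlt : ∀ t ∈ Set.Ioi (0:ℝ), 0 < B t * Real.exp (-z * t) := fun t ht =>
      mul_pos (hB t ht) (Real.exp_pos _)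
    rw [setIntegral_pos_iff_support_of_nonneg_ae
      ((ae_restrict_mem measurableSet_Ioi).mono fun t ht => (hlt t ht).le) (hB_int z hz),
      Set.inter_eq_self_of_subset_right (t := Set.Ioi 0) fun t ht =>
        Function.mem_support.mpr (hlt t ht).ne']
    simp
  have cross : ∀ s ∈ Set.Ioi (0:ℝ), ∀ t ∈ Set.Ioi (0:ℝ), s ≤ t →
      (A s * B t - A t * B s) *
        (Real.exp (-y * s) * Real.exp (-x * t) - Real.exp (-x * s) * Real.exp (-y * t)) ≤ 0 := by
    intro s hs t ht hst
    have hr := (div_le_div_iff₀ (hB s hs) (hB t ht)).mp (hratio hs ht hst)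
    refine mul_nonpos_of_nonpos_of_nonneg (sub_nonpos.mpr hr) (sub_nonneg.mpr ?_)
    rw [← Real.exp_add, ← Real.exp_add, Real.exp_le_exp]
    nlinarith [mul_nonneg (sub_nonneg.mpr hxy) (sub_nonneg.mpr hst)]
  refine (div_le_div_iff₀ (hpos y hy) (hpos x hx)).mpr <|
    setIntegral_mul_le_of_symmetrized_nonpos measurableSet_Ioi (hA_int x hx) (hA_int y hy)
      (hB_int x hx) (hB_int y hy) fun s hs t ht => ?_
  rcases le_total s t with hst | hst
  · linarith [cross s hs t ht hst]
  · linarith [cross t ht s hs hst]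
end
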